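/- Let M be a random symmetric n×n matrix with zero diagonal whose entries above the diagonal are independent, with M_ij = 1 − p_ij with probability p_ij and M_ij = −p_ij with probability 1 − p_ij. Suppose σ² ≥ C₁·(log n)/n for an appropriate absolute constant C₁ and p_ij ≤ σ² for all i,j. Then there is an absolute constant C₂ > 0 such that with probability 1 − o(1), the operator norm satisfies ‖M‖ ≤ C₂·σ·√n. -/

import Mathlib

open MeasureTheory Filter Finset

/-- The Bernoulli measure on `Bool` with success probability `p` (clamped to `[0,1]`). -/
noncomputable def bern (p : ℝ) : Measure Bool :=
  (PMF.bernoulli (min (Real.toNNReal p) 1) (min_le_right _ _)).toMeasure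

instance (p : ℝ) : IsProbabilityMeasure (bern p) := by
  unfold bern; infer_instance

/-- Index set for the unordered pairs of distinct vertices of `Fin N`. -/
abbrev EdgeIdx (N : ℕ) := {e : Fin N × Fin N // e.1 < e.2}

/-- A configuration of edges: which unordered pairs form an edge. -/
abbrev Config (N : ℕ) := EdgeIdx N → Bool

/-- A colored configuration: for every pair, (edge present, edge Red). For the censor
block model the second component is instead the noise bit of the pair. -/
abbrev CConfig (N : ℕ) := EdgeIdx N → Bool × Bool

/-- Adjacency relation of the graph determined by a configuration. -/
def adjOf {N : ℕ} (ω : Config N) (i j : Fin N) : Bool :=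
  if h : i < j then ω ⟨(i, j), h⟩ else if h : j < i then ω ⟨(j, i), h⟩ else false

/-- Degree of a vertex in the graph determined by a configuration. -/
def degOf {N : ℕ} (ω : Config N) (v : Fin N) : ℕ :=
  (univ.filter fun j => adjOf ω v j).card

/-- The two-block stochastic block model `SBM(n,a,b)` on `2*n` vertices: within-block
pairs are edges with probability `a/n`, cross-block pairs with probability `b/n`,
independently. -/
noncomputable def sbm2 (n : ℕ) (a b : ℝ) : Measure (Config (2 * n)) :=
  Measure.pi fun e =>
    bern (if ((e.1.1 : ℕ) < n ↔ (e.1.2 : ℕ) < n) then a / n else b / n)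

/-- The first block `V₁` (the first `n` vertices). -/
def block1 (n : ℕ) : Finset (Fin (2 * n)) := univ.filter fun i => (i : ℕ) < n

/-- The second block `V₂` (the last `n` vertices). -/
def block2 (n : ℕ) : Finset (Fin (2 * n)) := univ.filter fun i => ¬ (i : ℕ) < n

/-- `(V₁', V₂')` is `γ`-correct: `|Vᵢ ∩ Vᵢ'| ≥ (1-γ)n` for `i = 1,2`. -/
def correct2 (n : ℕ) (γ : ℝ) (P : Finset (Fin (2 * n)) × Finset (Fin (2 * n))) : Prop :=
  (1 - γ) * (n : ℝ) ≤ ((block1 n ∩ P.1).card : ℝ) ∧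
  (1 - γ) * (n : ℝ) ≤ ((block2 n ∩ P.2).card : ℝ)

/-- A pair of disjoint subsets partitioning the vertex set. -/
def isPartition2 {N : ℕ} (P : Finset (Fin N) × Finset (Fin N)) : Prop :=
  Disjoint P.1 P.2 ∧ P.1 ∪ P.2 = univ

/-- Expected adjacency matrix of `SBM(n,a,b)`. -/
noncomputable def expAdj (n : ℕ) (a b : ℝ) : Matrix (Fin (2 * n)) (Fin (2 * n)) ℝ :=
  fun i j => if i = j then 0 else if ((i : ℕ) < n ↔ (j : ℕ) < n) then a / n else b / n

/-- Adjacency matrix (over `ℝ`) of the graph determined by a configuration. -/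
noncomputable def adjMat {N : ℕ} (ω : Config N) : Matrix (Fin N) (Fin N) ℝ :=
  fun i j => if adjOf ω i j then 1 else 0

/-- Zero out all rows and columns corresponding to vertices of degree `> 20 d`. -/
noncomputable def zeroOutHighDeg {N : ℕ} (d : ℝ) (ω : Config N)
    (M : Matrix (Fin N) (Fin N) ℝ) : Matrix (Fin N) (Fin N) ℝ :=
  fun i j => if 20 * d < (degOf ω i : ℝ) ∨ 20 * d < (degOf ω j : ℝ) then 0 else M i j

/-- The spectral (ℓ² operator) norm of a real square matrix. -/
noncomputable def opNorm {N : ℕ} (M : Matrix (Fin N) (Fin N) ℝ) : ℝ :=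
  ‖LinearMap.toContinuousLinearMap (Matrix.toEuclideanLin M)‖

/-- The orthogonal projection onto a subspace, as an endomorphism. -/
noncomputable def projCLM {N : ℕ} (W : Submodule ℝ (EuclideanSpace ℝ (Fin N))) :
    EuclideanSpace ℝ (Fin N) →L[ℝ] EuclideanSpace ℝ (Fin N) :=
  W.subtypeL.comp W.orthogonalProjectionOnto

/-- `sin ∠(W₁, W₂) := ‖P_{W₁} - P_{W₂}‖`. -/
noncomputable def sinAngle {N : ℕ} (W₁ W₂ : Submodule ℝ (EuclideanSpace ℝ (Fin N))) : ℝ :=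
  ‖projCLM W₁ - projCLM W₂‖

/-- Build a vector of `EuclideanSpace ℝ (Fin N)` from its coordinates. -/
noncomputable def mkVec {N : ℕ} (f : Fin N → ℝ) : EuclideanSpace ℝ (Fin N) :=
  (EuclideanSpace.equiv (Fin N) ℝ).symm f

/-- `W` is the eigenspace corresponding to the top two eigenvalues of the symmetric
matrix `M`: it is spanned by two orthonormal eigenvectors whose eigenvalues dominate
every eigenvalue attained on `Wᗮ`. -/
def IsTopTwoSpace {N : ℕ} (M : Matrix (Fin N) (Fin N) ℝ)
    (W : Submodule ℝ (EuclideanSpace ℝ (Fin N))) : Prop :=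
  ∃ (u₁ u₂ : EuclideanSpace ℝ (Fin N)) (μ₁ μ₂ : ℝ),
    (inner ℝ u₁ u₂ : ℝ) = 0 ∧ ‖u₁‖ = 1 ∧ ‖u₂‖ = 1 ∧
    W = Submodule.span ℝ {u₁, u₂} ∧
    Matrix.toEuclideanLin M u₁ = μ₁ • u₁ ∧
    Matrix.toEuclideanLin M u₂ = μ₂ • u₂ ∧
    ∀ (μ : ℝ) (v : EuclideanSpace ℝ (Fin N)), v ≠ 0 → v ∈ Wᗮ →
      Matrix.toEuclideanLin M v = μ • v → μ ≤ min μ₁ μ₂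

/-- `P` is a possible output of the **Spectral Partition** algorithm run on the
configuration `ω` with degree parameter `d`. -/
def IsSpectralOutput (n : ℕ) (ω : Config (2 * n)) (d : ℝ)
    (P : Finset (Fin (2 * n)) × Finset (Fin (2 * n))) : Prop :=
  ∃ (W : Submodule ℝ (EuclideanSpace ℝ (Fin (2 * n))))
    (v : EuclideanSpace ℝ (Fin (2 * n))),
    IsTopTwoSpace (zeroOutHighDeg d ω (adjMat ω)) W ∧
    v ∈ W ∧ ‖v‖ = 1 ∧ (inner ℝ (projCLM W (mkVec fun _ => 1)) v : ℝ) = 0 ∧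
    P.1.card = n ∧ P.2 = P.1ᶜ ∧ ∀ i ∈ P.1, ∀ j ∈ P.2, v j ≤ v i

/-- The two-block SBM together with an independent fair Red/Blue coloring of each edge:
first component = edge present, second component = edge colored Red. -/
noncomputable def sbm2c (n : ℕ) (a b : ℝ) : Measure (CConfig (2 * n)) :=
  Measure.pi fun e =>
    (bern (if ((e.1.1 : ℕ) < n ↔ (e.1.2 : ℕ) < n) then a / n else b / n)).prod
      (bern (1 / 2))

/-- The Red subgraph of a colored configuration. -/
def redConf {N : ℕ} (ω : CConfig N) : Config N := fun e => (ω e).1 && (ω e).2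

/-- The Blue subgraph of a colored configuration. -/
def blueConf {N : ℕ} (ω : CConfig N) : Config N := fun e => (ω e).1 && !(ω e).2

/-- Number of Blue neighbors of `u` inside `S`. -/
noncomputable def blueDegIn {N : ℕ} (ω : CConfig N) (S : Finset (Fin N)) (u : Fin N) : ℕ :=
  (S.filter fun v => adjOf (blueConf ω) u v).card

/-- Number of Red neighbors of `u` inside `S`. -/
noncomputable def redDegIn {N : ℕ} (ω : CConfig N) (S : Finset (Fin N)) (u : Fin N) : ℕ :=
  (S.filter fun v => adjOf (redConf ω) u v).card

/-- The **Correction** subroutine with threshold `t`: a vertex of `P.i` is bad if it has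
at least `t` Blue neighbors in the other class; bad vertices are moved to the other side. -/
noncomputable def corrected2 {N : ℕ} (t : ℝ) (ω : CConfig N)
    (P : Finset (Fin N) × Finset (Fin N)) : Finset (Fin N) × Finset (Fin N) :=
  let bad1 := P.1.filter fun u => t ≤ (blueDegIn ω P.2 u : ℝ)
  let bad2 := P.2.filter fun u => t ≤ (blueDegIn ω P.1 u : ℝ)
  ((P.1 \ bad1) ∪ bad2, (P.2 \ bad2) ∪ bad1)

/-- The `k`-block SBM on `k*m` vertices (`k` blocks of size `m`, so `n = k*m` total
vertices and edge probabilities `a/n` within blocks and `b/n` across). -/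
noncomputable def sbmK (k m : ℕ) (a b : ℝ) : Measure (Config (k * m)) :=
  Measure.pi fun e =>
    bern (if (e.1.1 : ℕ) / m = (e.1.2 : ℕ) / m then a / (k * m) else b / (k * m))

/-- The `i`-th block `Vᵢ` (of size `m = n/k`). -/
def blockK (k m : ℕ) (i : Fin k) : Finset (Fin (k * m)) :=
  univ.filter fun v => (v : ℕ) / m = (i : ℕ)

/-- The subset `Z` selected by the splitting coins `s` (its complement is `Y`). -/
def Zset {N : ℕ} (s : Fin N → Bool) : Finset (Fin N) := univ.filter fun v => s v = true

/-- The `k`-block SBM together with a uniformly random split of the vertices. -/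
noncomputable def sbmKs (k m : ℕ) (a b : ℝ) :
    Measure ((Fin (k * m) → Bool) × Config (k * m)) :=
  (Measure.pi fun _ : Fin (k * m) => bern (1 / 2)).prod (sbmK k m a b)

/-- The `k`-block SBM together with a uniformly random split of the vertices and an
independent fair Red/Blue coloring of each edge. -/
noncomputable def sbmKsc (k m : ℕ) (a b : ℝ) :
    Measure ((Fin (k * m) → Bool) × CConfig (k * m)) :=
  (Measure.pi fun _ : Fin (k * m) => bern (1 / 2)).prod
    (Measure.pi fun e : EdgeIdx (k * m) =>
      (bern (if (e.1.1 : ℕ) / m = (e.1.2 : ℕ) / m then a / (k * m) else b / (k * m))).prod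
        (bern (1 / 2)))

/-- `U` is a `γ`-correct partition of `Z = (V₁ ∩ Z) ∪ ... ∪ (V_k ∩ Z)`:
a collection of disjoint subsets of `Z` covering `Z` with
`|(Vᵢ ∩ Z) ∩ Uᵢ| ≥ (1-γ)|Vᵢ ∩ Z|` for every `i`. -/
def correctOnZ (k m : ℕ) (γ : ℝ) (s : Fin (k * m) → Bool)
    (U : Fin k → Finset (Fin (k * m))) : Prop :=
  (∀ i, U i ⊆ Zset s) ∧ (∀ i j, i ≠ j → Disjoint (U i) (U j)) ∧
  (univ.biUnion U = Zset s) ∧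
  ∀ i, (1 - γ) * ((blockK k m i ∩ Zset s).card : ℝ) ≤
    (((blockK k m i ∩ Zset s) ∩ U i).card : ℝ)

/-- Censor block model: for every pair of vertices, an independent pair
(edge present with probability `p`, noise bit with probability `ε`). -/
noncomputable def cbmMeasure (n : ℕ) (p ε : ℝ) : Measure (CConfig (2 * n)) :=
  Measure.pi fun _ => (bern p).prod (bern ε)

/-- The observation `y = B_G x ⊕ z` of the censor block model: for each present edge
`(i,j)` one observes `x_i ⊕ x_j ⊕ z_e` (where `x` is the indicator of the second
block); nothing is observed on absent edges. -/
def cbmObs (n : ℕ) (ω : CConfig (2 * n)) (e : EdgeIdx (2 * n)) : Option Bool :=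
  if (ω e).1 then
    some (xor (xor (decide ((e.1.1 : ℕ) < n)) (decide ((e.1.2 : ℕ) < n))) (ω e).2)
  else none

/-- `e(S,T)`: adjacency-matrix count of edges between `S` and `T` in a simple graph. -/
def eCount {n : ℕ} (G : SimpleGraph (Fin n)) [DecidableRel G.Adj]
    (S T : Finset (Fin n)) : ℝ :=
  ∑ i ∈ S, ∑ j ∈ T, if G.Adj i j then 1 else 0

/-- `e(S,T)` for the graph of a configuration. -/
def eCountC {n : ℕ} (ω : Config n) (S T : Finset (Fin n)) : ℝ :=
  ∑ i ∈ S, ∑ j ∈ T, if adjOf ω i j then 1 else 0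

/-- The random symmetric matrix model: independent edges, pair `(i,j)` present with
probability `p i j`. -/
noncomputable def genMeasure {n : ℕ} (p : Fin n → Fin n → ℝ) : Measure (Config n) :=
  Measure.pi fun e => bern (p e.1.1 e.1.2)

/-- The centered matrix `M` with `M_ij = 1 - p_ij` if the pair is present and
`M_ij = -p_ij` otherwise, and zero diagonal. -/
noncomputable def centeredMat {n : ℕ} (p : Fin n → Fin n → ℝ) (ω : Config n) :
    Matrix (Fin n) (Fin n) ℝ :=
  fun i j => if i = j then 0 else (if adjOf ω i j then 1 else 0) - p i j

/-- Number of positive entries in row `i` of `M`. -/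
noncomputable def posRowCount {n : ℕ} (M : Matrix (Fin n) (Fin n) ℝ) (i : Fin n) : ℕ :=
  (univ.filter fun j => 0 < M i j).card

/-- Zero out the rows and columns indexed by `S`. -/
noncomputable def zeroOutRows {n : ℕ} (S : Finset (Fin n)) (M : Matrix (Fin n) (Fin n) ℝ) :
    Matrix (Fin n) (Fin n) ℝ :=
  fun i j => if i ∈ S ∨ j ∈ S then 0 else M i j

/-- The all-ones direction `v̄₁` (unit vector). -/
noncomputable def vbar1 (n : ℕ) : EuclideanSpace ℝ (Fin (2 * n)) :=
  mkVec fun _ => 1 / Real.sqrt (2 * n)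

/-- The block-indicator direction `v̄₂` (unit vector). -/
noncomputable def vbar2 (n : ℕ) : EuclideanSpace ℝ (Fin (2 * n)) :=
  mkVec fun i =>
    if (i : ℕ) < n then 1 / Real.sqrt (2 * n) else -(1 / Real.sqrt (2 * n))

/-- Entries of matrix powers are sums over walks. -/
theorem matrix_pow_apply_eq_sum_walks {ι : Type*} [Fintype ι] [DecidableEq ι]
    (M : Matrix ι ι ℝ) (L : ℕ) (i j : ι) :
    (M ^ L) i j = ∑ u : Fin (L + 1) → ι,
      if u 0 = i ∧ u (Fin.last L) = j then ∏ t : Fin L, M (u t.castSucc) (u t.succ) else 0 := by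
  induction L generalizing i with
  | zero =>
    rw [← (Equiv.funUnique (Fin 1) ι).symm.sum_comp]
    simp [Matrix.one_apply, ite_and]
  | succ L ih =>
    rw [pow_succ', Matrix.mul_apply, ← (Fin.consEquiv fun _ : Fin (L + 2) => ι).sum_comp,
      Fintype.sum_prod_type_right]
    simp_rw [ih, Finset.mul_sum]
    rw [Finset.sum_comm]
    refine Finset.sum_congr rfl fun v _ => ?_
    have hlast : Fin.last (L + 1) = (Fin.last L).succ := rfl
    simp only [Fin.consEquiv_apply, Fin.prod_univ_succ, Fin.castSucc_zero, Fin.cons_zero,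
      Fin.cons_succ, hlast, ← Fin.succ_castSucc]
    simp [ite_and]

/-- The trace of a matrix power is the sum over closed walks. -/
theorem trace_pow_eq_sum_walks {ι : Type*} [Fintype ι] [DecidableEq ι]
    (M : Matrix ι ι ℝ) (L : ℕ) :
    (M ^ L).trace = ∑ u : Fin (L + 1) → ι,
      if u 0 = u (Fin.last L) then ∏ t : Fin L, M (u t.castSucc) (u t.succ) else 0 := by
  simp only [Matrix.trace, Matrix.diag, matrix_pow_apply_eq_sum_walks]
  rw [Finset.sum_comm]
  refine Finset.sum_congr rfl fun u _ => ?_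
  simp [ite_and, eq_comm]

theorem norm_pow_le_of_isSelfAdjoint {A : Type*} [NormedRing A] [StarRing A] [CStarRing A]
    {a : A} (ha : IsSelfAdjoint a) (k : ℕ) : ‖a‖ ^ (k + 1) ≤ ‖a ^ (k + 1)‖ := by
  obtain h | h := (norm_nonneg a).eq_or_lt
  · simp [← h]
  have hk : k + 1 ≤ 2 ^ (k + 1) := Nat.lt_two_pow_self.le
  obtain ⟨m, hm⟩ := Nat.exists_eq_add_of_le hk
  have h1 := ha.norm_pow_two_pow (k + 1)
  rw [hm] at h1
  obtain rfl | hm0 := Nat.eq_zero_or_pos m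
  · simpa using h1.ge
  have h2 : ‖a‖ ^ (k + 1) * ‖a‖ ^ m ≤ ‖a ^ (k + 1)‖ * ‖a‖ ^ m := by
    rw [← pow_add, ← h1, pow_add]
    exact (norm_mul_le _ _).trans (by gcongr; exact norm_pow_le' a hm0)
  exact le_of_mul_le_mul_right h2 (by positivity)

theorem opNorm_eq_norm_toEuclideanCLM {n : ℕ} (M : Matrix (Fin n) (Fin n) ℝ) :
    opNorm M = ‖Matrix.toEuclideanCLM (n := Fin n) (𝕜 := ℝ) M‖ := rfl

theorem abs_apply_le_opNorm {n : ℕ} (M : Matrix (Fin n) (Fin n) ℝ) (i j : Fin n) :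
    |M i j| ≤ opNorm M := by
  have h := Matrix.inner_toEuclideanCLM M (EuclideanSpace.single i 1) (EuclideanSpace.single j 1)
  have h2 : EuclideanSpace.single i (1 : ℝ) ⬝ᵥ M.mulVec (EuclideanSpace.single j (1 : ℝ))
      = M i j := by simp
  rw [h2] at h
  rw [← h, opNorm_eq_norm_toEuclideanCLM]
  refine (abs_real_inner_le_norm _ _).trans ?_
  have := (Matrix.toEuclideanCLM (n := Fin n) (𝕜 := ℝ) M).le_opNorm (EuclideanSpace.single j 1)
  simpa using this

theorem trace_pow_le {n : ℕ} (M : Matrix (Fin n) (Fin n) ℝ) (k : ℕ) :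
    (M ^ (k + 1)).trace ≤ n * opNorm M ^ (k + 1) := by
  have h : opNorm (M ^ (k + 1)) ≤ opNorm M ^ (k + 1) := by
    rw [opNorm_eq_norm_toEuclideanCLM, opNorm_eq_norm_toEuclideanCLM, map_pow]
    exact norm_pow_le' _ k.succ_pos
  calc (M ^ (k + 1)).trace ≤ ∑ _i : Fin n, opNorm M ^ (k + 1) :=
        Finset.sum_le_sum fun i _ => (le_abs_self _).trans ((abs_apply_le_opNorm _ i i).trans h)
    _ = _ := by simp

theorem opNorm_pow_le_trace {n : ℕ} {M : Matrix (Fin n) (Fin n) ℝ} (hM : M.IsSymm) (k : ℕ) :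
    opNorm M ^ (2 * (k + 1)) ≤ (M ^ (2 * (k + 1))).trace := by
  have hs : IsSelfAdjoint (Matrix.toEuclideanCLM (n := Fin n) (𝕜 := ℝ) M) := by
    rw [IsSelfAdjoint, ← map_star, Matrix.star_eq_conjTranspose,
      Matrix.conjTranspose_eq_transpose_of_trivial, hM]
  have h1 : opNorm M ^ (k + 1) ≤ opNorm (M ^ (k + 1)) := by
    rw [opNorm_eq_norm_toEuclideanCLM, opNorm_eq_norm_toEuclideanCLM, map_pow]
    exact norm_pow_le_of_isSelfAdjoint hs k
  have hP : (M ^ (k + 1)).IsSymm := by rw [Matrix.IsSymm, Matrix.transpose_pow, hM]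
  set P := M ^ (k + 1) with hPdef
  have htr : (M ^ (2 * (k + 1))).trace = ∑ i, ∑ j, P i j ^ 2 := by
    rw [two_mul, pow_add, ← hPdef, Matrix.trace]
    refine Finset.sum_congr rfl fun i _ => ?_
    rw [Matrix.diag, Matrix.mul_apply]
    refine Finset.sum_congr rfl fun j _ => ?_
    rw [hP.apply i j, sq]
  have h2 : opNorm P ≤ Real.sqrt (∑ i, ∑ j, P i j ^ 2) := by
    refine ContinuousLinearMap.opNorm_le_bound _ (Real.sqrt_nonneg _) fun x => ?_
    rw [EuclideanSpace.norm_eq, EuclideanSpace.norm_eq, ← Real.sqrt_mul (by positivity)]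
    refine Real.sqrt_le_sqrt ?_
    rw [Finset.sum_mul]
    refine Finset.sum_le_sum fun i _ => ?_
    simp only [Real.norm_eq_abs, sq_abs]
    have : (LinearMap.toContinuousLinearMap (Matrix.toEuclideanLin P) x) i
        = ∑ j, P i j * x j := rfl
    rw [this]
    exact Finset.sum_mul_sq_le_sq_mul_sq _ _ _
  have h0 : 0 ≤ opNorm P := norm_nonneg _
  have h00 : 0 ≤ opNorm M := norm_nonneg _
  rw [htr, mul_comm 2, pow_mul]
  calc (opNorm M ^ (k + 1)) ^ 2 ≤ opNorm P ^ 2 := by gcongr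
    _ ≤ _ := by
      rw [← Real.sq_sqrt (show 0 ≤ ∑ i, ∑ j, P i j ^ 2 by positivity)]
      gcongr

/-- A closed walk without loops that traverses each of its edges at least twice. -/
def IsDoubleWalk {α : Type*} {L : ℕ} (u : Fin (L + 1) → α) : Prop :=
  u 0 = u (Fin.last L) ∧ (∀ t : Fin L, u t.castSucc ≠ u t.succ) ∧
    ∀ t : Fin L, ∃ s ≠ t, s(u s.castSucc, u s.succ) = s(u t.castSucc, u t.succ)

theorem isDoubleWalk_comp_iff {α β : Type*} {L : ℕ} (u : Fin (L + 1) → α) {f : α → β}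
    (hf : Function.Injective f) : IsDoubleWalk (f ∘ u) ↔ IsDoubleWalk u := by
  have h : ∀ a b c d : α, s(f a, f b) = s(f c, f d) ↔ s(a, b) = s(c, d) := fun a b c d => by
    simp only [Sym2.eq_iff, hf.eq_iff]
  simp only [IsDoubleWalk, Function.comp_apply, h, hf.eq_iff, ne_eq]

/-- A walk visits at most one more vertex than its number of distinct edges. -/
theorem card_image_le_card_image_edges_add_one {α E : Type*} [DecidableEq α] [DecidableEq E] {L : ℕ}
    (u : Fin (L + 1) → α) (ed : Fin L → E)
    (h : ∀ s t, ed s = ed t → s(u s.castSucc, u s.succ) = s(u t.castSucc, u t.succ)) :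
    (univ.image u).card ≤ (univ.image ed).card + 1 := by
  induction L with
  | zero => simp
  | succ L ih =>
    have ih := ih (u ∘ Fin.castSucc) (ed ∘ Fin.castSucc) fun s t hst => h _ _ hst
    have hu : univ.image u = insert (u (Fin.last _)) (univ.image (u ∘ Fin.castSucc)) := by
      ext a; simp [Fin.exists_fin_succ', eq_comm, or_comm]
    have he : univ.image ed = insert (ed (Fin.last _)) (univ.image (ed ∘ Fin.castSucc)) := by
      ext a; simp [Fin.exists_fin_succ', eq_comm, or_comm]
    rw [hu, he]
    by_cases hv : u (Fin.last _) ∈ univ.image (u ∘ Fin.castSucc)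
    · rw [Finset.insert_eq_of_mem hv]
      exact ih.trans (by gcongr; exact Finset.subset_insert _ _)
    · have hn : ed (Fin.last _) ∉ univ.image (ed ∘ Fin.castSucc) := by
        intro hmem
        obtain ⟨s, -, hs⟩ := Finset.mem_image.1 hmem
        apply hv
        have h1 := h _ _ hs
        have h2 : u (Fin.last (L + 1)) ∈ s(u s.castSucc.castSucc, u s.castSucc.succ) := by
          rw [h1, ← Fin.succ_last]; exact Sym2.mem_mk_right _ _
        rcases Sym2.mem_iff.1 h2 with h2 | h2
        · exact Finset.mem_image.2 ⟨s.castSucc, mem_univ _, h2.symm⟩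
        · exact Finset.mem_image.2 ⟨s.succ, mem_univ _, by
            rw [Function.comp_apply, ← Fin.succ_castSucc]; exact h2.symm⟩
      rw [Finset.card_insert_of_notMem hv, Finset.card_insert_of_notMem hn]
      omega

theorem IsDoubleWalk.card_image_le {α : Type*} [DecidableEq α] {k : ℕ}
    {u : Fin (2 * k + 1) → α} (hu : IsDoubleWalk u) : (univ.image u).card ≤ k + 1 := by
  let ed : Fin (2 * k) → Sym2 α := fun t => s(u t.castSucc, u t.succ)
  have h1 := card_image_le_card_image_edges_add_one u ed fun _ _ h => h
  have h2 : 2 * (univ.image ed).card ≤ (univ : Finset (Fin (2 * k))).card := by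
    refine Finset.mul_card_image_le_card _ _ fun b hb => ?_
    obtain ⟨t, -, rfl⟩ := Finset.mem_image.1 hb
    obtain ⟨s, hst, hs⟩ := hu.2.2 t
    exact Finset.one_lt_card.2
      ⟨s, Finset.mem_filter.2 ⟨mem_univ _, hs⟩, t, Finset.mem_filter.2 ⟨mem_univ _, rfl⟩, hst⟩
  simp only [Finset.card_univ, Fintype.card_fin] at h2
  omega

/-- Maps with a prescribed kernel correspond to embeddings of the quotient. -/
def kerEqEquivEmbedding {A : Type*} (B : Type*) (π : Setoid A) :
    {u : A → B // Setoid.ker u = π} ≃ (Quotient π ↪ B) where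
  toFun u := ⟨Quotient.lift u.1 fun a b h => by
      have h' : π a b := h
      rwa [← u.2] at h', by
    intro x y
    induction x using Quotient.inductionOn
    induction y using Quotient.inductionOn
    intro h
    refine Quotient.sound ?_
    rename_i a b
    change π a b
    rw [← u.2]
    exact h⟩
  invFun f := ⟨fun a => f (Quotient.mk π a), by
    ext a b
    rw [Setoid.ker_def, f.injective.eq_iff]
    exact Quotient.eq⟩
  left_inv u := rfl
  right_inv f := by
    ext x
    induction x using Quotient.inductionOn
    rfl

theorem sum_comp_ker {A B : Type*} [Fintype A] [DecidableEq A] [Fintype B] [Fintype (Setoid A)]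
    (F : Setoid A → ℝ) :
    ∑ u : A → B, F (Setoid.ker u) =
      ∑ π : Setoid A, ((Fintype.card B).descFactorial (Nat.card (Quotient π)) : ℝ) * F π := by
  classical
  rw [← Finset.sum_fiberwise (s := univ) (g := fun u : A → B => Setoid.ker u)]
  refine Finset.sum_congr rfl fun π _ => ?_
  rw [Finset.sum_congr rfl (g := fun _ => F π) fun u hu => by rw [(Finset.mem_filter.1 hu).2],
    Finset.sum_const, nsmul_eq_mul]
  congr 2
  let _ : Fintype (Quotient π) := Fintype.ofFinite _
  rw [Nat.card_eq_fintype_card, ← Fintype.card_embedding_eq, ← Fintype.card_subtype]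
  exact Fintype.card_congr (kerEqEquivEmbedding B π)

theorem isDoubleWalk_iff_ker {α : Type*} {L : ℕ} (u : Fin (L + 1) → α) :
    IsDoubleWalk u ↔ IsDoubleWalk (fun t => Quotient.mk (Setoid.ker u) t) :=
  isDoubleWalk_comp_iff (fun t => Quotient.mk (Setoid.ker u) t)
    (f := Setoid.kerLift u) (Setoid.kerLift_injective u)

theorem card_image_eq_card_quotient_ker {A α : Type*} [Fintype A] [DecidableEq α] (u : A → α) :
    (univ.image u).card = Nat.card (Quotient (Setoid.ker u)) := by
  rw [Nat.card_congr (Setoid.quotientKerEquivRange u), ← Set.image_univ, ← Finset.coe_univ,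
    ← Finset.coe_image, Nat.card_coe_set_eq, Set.ncard_coe_finset]

theorem descFactorial_mul_pow_le {n k m : ℕ} {q : ℝ} (hq : 0 ≤ q) (hk : n * q ≤ k) (hm : m ≤ k) :
    2 * k * ((n.descFactorial (m + 1) : ℝ) * q ^ m) ≤ n * (2 * k).descFactorial (m + 1) := by
  have h1 : (n.descFactorial (m + 1) : ℝ) ≤ n * n ^ m := by
    rw [← pow_succ']; exact_mod_cast Nat.descFactorial_le_pow n (m + 1)
  have h2 : (2 * k * k ^ m : ℝ) ≤ (2 * k).descFactorial (m + 1) := by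
    obtain rfl | hk0 := Nat.eq_zero_or_pos k
    · simp
    obtain ⟨r, hr⟩ : ∃ r, 2 * k = r + 1 := ⟨2 * k - 1, by omega⟩
    have h3 : k ^ m ≤ r.descFactorial m :=
      (Nat.pow_le_pow_left (by omega) m).trans (Nat.pow_sub_le_descFactorial r m)
    have h4 : 2 * k * k ^ m ≤ (2 * k).descFactorial (m + 1) := by
      rw [hr, Nat.succ_descFactorial_succ]
      exact Nat.mul_le_mul_left _ h3
    exact_mod_cast h4
  calc 2 * k * ((n.descFactorial (m + 1) : ℝ) * q ^ m) ≤ 2 * k * ((n * n ^ m) * q ^ m) := by gcongr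
    _ = n * (2 * k * (n * q) ^ m) := by rw [mul_pow]; ring
    _ ≤ n * (2 * k * k ^ m) := by gcongr
    _ ≤ _ := by gcongr

open Classical in
/-- Weighted double walks on `n` vertices are dominated by double walks on `2 * k` vertices. -/
theorem sum_isDoubleWalk_le {n k : ℕ} {q : ℝ} (hq : 0 ≤ q) (hk : n * q ≤ k) :
    2 * k * ∑ u : Fin (2 * k + 1) → Fin n,
        (if IsDoubleWalk u then q ^ ((univ.image u).card - 1) else 0) ≤
      n * ∑ u : Fin (2 * k + 1) → Fin (2 * k), if IsDoubleWalk u then (1 : ℝ) else 0 := by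
  let _ : Finite (Setoid (Fin (2 * k + 1))) :=
    Finite.of_injective (fun π : Setoid (Fin (2 * k + 1)) => π.r) fun _ _ h =>
      Setoid.ext fun a b => by simpa using congrFun (congrFun h a) b
  let _ : Fintype (Setoid (Fin (2 * k + 1))) := Fintype.ofFinite _
  let D : Setoid (Fin (2 * k + 1)) → Prop := fun π => IsDoubleWalk fun t => Quotient.mk π t
  have e1 := sum_comp_ker (B := Fin n)
    fun π => if D π then q ^ (Nat.card (Quotient π) - 1) else 0
  have e2 := sum_comp_ker (B := Fin (2 * k)) fun π => if D π then (1 : ℝ) else 0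
  simp only [D, ← isDoubleWalk_iff_ker, ← card_image_eq_card_quotient_ker] at e1 e2
  rw [e1, e2, Finset.mul_sum, Finset.mul_sum]
  refine Finset.sum_le_sum fun π _ => ?_
  split_ifs with h
  · have hc := h.card_image_le
    have hc2 : (univ.image fun t => Quotient.mk π t).card = Nat.card (Quotient π) := by
      rw [Finset.image_univ_of_surjective Quotient.mk_surjective, Finset.card_univ,
        Nat.card_eq_fintype_card]
    have hpos : 0 < Nat.card (Quotient π) := Nat.card_pos_iff.2 ⟨⟨Quotient.mk π 0⟩, inferInstance⟩
    rw [hc2] at hc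
    obtain ⟨m, hm⟩ : ∃ m, Nat.card (Quotient π) = m + 1 := ⟨_, (Nat.sub_add_cancel hpos).symm⟩
    rw [hm] at hc ⊢
    simpa using descFactorial_mul_pow_le hq hk (by omega : m ≤ k)
  · simp

theorem integral_bern {p : ℝ} (h0 : 0 ≤ p) (h1 : p ≤ 1) (f : Bool → ℝ) :
    ∫ b, f b ∂bern p = p * f true + (1 - p) * f false := by
  rw [bern, PMF.integral_eq_sum]
  have h : p.toNNReal ≤ 1 := Real.toNNReal_le_one.2 h1
  simp [PMF.bernoulli, PMF.ofFintype_apply, h0, h]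

/-- The `m`-th central moment of a Bernoulli variable. -/
def bernMoment (p : ℝ) (m : ℕ) : ℝ := p * (1 - p) ^ m + (1 - p) * (-p) ^ m

theorem bernMoment_zero (p : ℝ) : bernMoment p 0 = 1 := by simp [bernMoment]

theorem bernMoment_one (p : ℝ) : bernMoment p 1 = 0 := by simp only [bernMoment]; ring

theorem abs_bernMoment_le {p : ℝ} (h0 : 0 ≤ p) (h1 : p ≤ 1) (m : ℕ) :
    |bernMoment p (m + 2)| ≤ p := by
  have ha : |(1 - p) ^ m| ≤ 1 := by
    rw [abs_pow]; exact pow_le_one₀ (abs_nonneg _) (abs_le.2 ⟨by linarith, by linarith⟩)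
  have hb : |(-p) ^ m| ≤ 1 := by
    rw [abs_pow]; exact pow_le_one₀ (abs_nonneg _) (abs_le.2 ⟨by linarith, by linarith⟩)
  have e : bernMoment p (m + 2)
      = p * (1 - p) * ((1 - p) * (1 - p) ^ m + p * (-p) ^ m) := by
    simp only [bernMoment]; ring
  have h3 : |(1 - p) * (1 - p) ^ m + p * (-p) ^ m| ≤ 1 := by
    refine (abs_add_le _ _).trans ?_
    rw [abs_mul, abs_mul, abs_of_nonneg h0, abs_of_nonneg (sub_nonneg.2 h1)]
    nlinarith
  rw [e, abs_mul, abs_of_nonneg (mul_nonneg h0 (sub_nonneg.2 h1))]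
  nlinarith [mul_nonneg h0 (sub_nonneg.2 h1)]

theorem one_le_pow_mul_bernMoment_third (m : ℕ) :
    1 ≤ 3 ^ (m + 2) * bernMoment (1 / 3) (m + 2) := by
  have e : (3 : ℝ) ^ (m + 2) * bernMoment (1 / 3) (m + 2)
      = (4 * 2 ^ m + 2 * (-1) ^ m) / 3 := by
    have h2 : (2 : ℝ) ^ m = 3 ^ m * (2 / 3) ^ m := by rw [← mul_pow]; norm_num
    have h1 : (-1 : ℝ) ^ m = 3 ^ m * (-(1 / 3)) ^ m := by rw [← mul_pow]; norm_num
    rw [h1, h2, bernMoment, show (1 : ℝ) - 1 / 3 = 2 / 3 by norm_num]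
    ring
  rw [e]
  obtain rfl | hm := Nat.eq_zero_or_pos m
  · norm_num
  have h2 : (2 : ℝ) ≤ 2 ^ m := le_self_pow₀ (by norm_num) hm.ne'
  have h1 : (-1 : ℝ) ≤ (-1) ^ m := (abs_le.1 (by simp [abs_pow])).1
  linarith

/-- The unordered pair of two distinct vertices. -/
def edgeOf {n : ℕ} (i j : Fin n) (h : i ≠ j) : EdgeIdx n :=
  if h' : i < j then ⟨(i, j), h'⟩ else ⟨(j, i), lt_of_le_of_ne (not_lt.1 h') h.symm⟩

theorem sym2_edgeOf {n : ℕ} {i j : Fin n} (h : i ≠ j) :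
    s((edgeOf i j h).1.1, (edgeOf i j h).1.2) = s(i, j) := by
  unfold edgeOf
  split_ifs
  · rfl
  · exact Sym2.eq_swap

theorem edgeOf_eq_iff {n : ℕ} {i j k l : Fin n} (h : i ≠ j) (h' : k ≠ l) :
    edgeOf i j h = edgeOf k l h' ↔ s(i, j) = s(k, l) := by
  constructor
  · intro e
    rw [← sym2_edgeOf h, ← sym2_edgeOf h', e]
  · intro e
    rcases Sym2.eq_iff.1 e with ⟨rfl, rfl⟩ | ⟨rfl, rfl⟩
    · rfl
    · unfold edgeOf
      rcases lt_or_gt_of_ne h with h1 | h1 <;> simp [h1, h1.not_gt]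

/-- The centered indicator of an edge. -/
def edgeVal {n : ℕ} (p : Fin n → Fin n → ℝ) (e : EdgeIdx n) (b : Bool) : ℝ :=
  (if b then 1 else 0) - p e.1.1 e.1.2

theorem centeredMat_of_ne {n : ℕ} {p : Fin n → Fin n → ℝ} (hp : ∀ i j, p i j = p j i)
    (ω : Config n) {i j : Fin n} (h : i ≠ j) :
    centeredMat p ω i j = edgeVal p (edgeOf i j h) (ω (edgeOf i j h)) := by
  rcases lt_or_gt_of_ne h with h1 | h1
  · simp [centeredMat, adjOf, edgeOf, edgeVal, h, h1]
  · simp [centeredMat, adjOf, edgeOf, edgeVal, h, h1, h1.not_gt, hp i j]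

theorem centeredMat_self {n : ℕ} (p : Fin n → Fin n → ℝ) (ω : Config n) (i : Fin n) :
    centeredMat p ω i i = 0 := by simp [centeredMat]

theorem centeredMat_isSymm {n : ℕ} {p : Fin n → Fin n → ℝ} (hp : ∀ i j, p i j = p j i)
    (ω : Config n) : (centeredMat p ω).IsSymm := by
  refine Matrix.IsSymm.ext fun i j => ?_
  obtain rfl | h := eq_or_ne i j
  · rfl
  · rw [centeredMat_of_ne hp ω h, centeredMat_of_ne hp ω h.symm,
      (edgeOf_eq_iff h.symm h).2 Sym2.eq_swap]

instance {n : ℕ} (p : Fin n → Fin n → ℝ) : IsProbabilityMeasure (genMeasure p) := by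
  unfold genMeasure; infer_instance

theorem integral_walk_eq_prod {n L : ℕ} {p : Fin n → Fin n → ℝ} (h0 : ∀ i j, 0 ≤ p i j)
    (h1 : ∀ i j, p i j ≤ 1) (hp : ∀ i j, p i j = p j i) (u : Fin (L + 1) → Fin n)
    (hu : ∀ t : Fin L, u t.castSucc ≠ u t.succ) :
    ∫ ω, ∏ t : Fin L, centeredMat p ω (u t.castSucc) (u t.succ) ∂genMeasure p =
      ∏ e : EdgeIdx n, bernMoment (p e.1.1 e.1.2)
        (univ.filter fun t : Fin L => edgeOf _ _ (hu t) = e).card := by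
  have h : ∀ ω : Config n, ∏ t : Fin L, centeredMat p ω (u t.castSucc) (u t.succ) =
      ∏ e : EdgeIdx n,
        edgeVal p e (ω e) ^ (univ.filter fun t : Fin L => edgeOf _ _ (hu t) = e).card := by
    intro ω
    rw [← Finset.prod_fiberwise (s := univ) (g := fun t => edgeOf _ _ (hu t))]
    refine Finset.prod_congr rfl fun e _ => ?_
    rw [Finset.prod_congr rfl (g := fun _ => edgeVal p e (ω e)) fun t ht => ?_, Finset.prod_const]
    rw [centeredMat_of_ne hp ω (hu t), (Finset.mem_filter.1 ht).2]
  simp_rw [h, genMeasure]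
  rw [integral_fintype_prod_eq_prod
    (f := fun e b => edgeVal p e b ^ (univ.filter fun t : Fin L => edgeOf _ _ (hu t) = e).card)]
  refine Finset.prod_congr rfl fun e _ => ?_
  rw [integral_bern (h0 _ _) (h1 _ _)]
  simp [edgeVal, bernMoment]

theorem integral_walk_eq_zero {n L : ℕ} {p : Fin n → Fin n → ℝ} (h0 : ∀ i j, 0 ≤ p i j)
    (h1 : ∀ i j, p i j ≤ 1) (hp : ∀ i j, p i j = p j i) (u : Fin (L + 1) → Fin n)
    (hc : u 0 = u (Fin.last L)) (hu : ¬ IsDoubleWalk u) :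
    ∫ ω, ∏ t : Fin L, centeredMat p ω (u t.castSucc) (u t.succ) ∂genMeasure p = 0 := by
  by_cases hl : ∀ t : Fin L, u t.castSucc ≠ u t.succ
  · have hex : ∃ t : Fin L, ∀ s ≠ t, s(u s.castSucc, u s.succ) ≠ s(u t.castSucc, u t.succ) := by
      by_contra! h
      exact hu ⟨hc, hl, h⟩
    obtain ⟨t, ht⟩ := hex
    rw [integral_walk_eq_prod h0 h1 hp u hl]
    refine Finset.prod_eq_zero (mem_univ (edgeOf _ _ (hl t))) ?_
    have : (univ.filter fun s : Fin L => edgeOf _ _ (hl s) = edgeOf _ _ (hl t)) = {t} := by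
      ext s
      simp only [Finset.mem_filter, Finset.mem_univ, true_and, Finset.mem_singleton,
        edgeOf_eq_iff]
      exact ⟨fun h => by_contra fun hne => ht s hne h, fun h => by rw [h]⟩
    rw [this, Finset.card_singleton, bernMoment_one]
  · push Not at hl
    obtain ⟨t, ht⟩ := hl
    have : ∀ ω, ∏ t : Fin L, centeredMat p ω (u t.castSucc) (u t.succ) = 0 := fun ω =>
      Finset.prod_eq_zero (mem_univ t) (by rw [ht, centeredMat_self])
    simp [this]

/-- Along a double walk every edge multiplicity is `0` or at least `2`. -/
theorem IsDoubleWalk.card_fiber {n L : ℕ} {u : Fin (L + 1) → Fin n} (hu : IsDoubleWalk u)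
    {e : EdgeIdx n} (he : e ∈ univ.image fun t => edgeOf _ _ (hu.2.1 t)) :
    ∃ m, (univ.filter fun t : Fin L => edgeOf _ _ (hu.2.1 t) = e).card = m + 2 := by
  obtain ⟨t, -, rfl⟩ := Finset.mem_image.1 he
  obtain ⟨s, hst, hs⟩ := hu.2.2 t
  have : 1 < (univ.filter fun s : Fin L =>
      edgeOf _ _ (hu.2.1 s) = edgeOf _ _ (hu.2.1 t)).card :=
    Finset.one_lt_card.2 ⟨s, Finset.mem_filter.2 ⟨mem_univ _, (edgeOf_eq_iff _ _).2 hs⟩, t,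
      Finset.mem_filter.2 ⟨mem_univ _, rfl⟩, hst⟩
  exact ⟨_, (Nat.sub_add_cancel this).symm⟩

theorem card_fiber_of_notMem {n L : ℕ} {ed : Fin L → EdgeIdx n} {e : EdgeIdx n}
    (he : e ∉ univ.image ed) : (univ.filter fun t => ed t = e).card = 0 := by
  rw [Finset.card_eq_zero, Finset.filter_eq_empty_iff]
  exact fun t _ h => he (Finset.mem_image.2 ⟨t, mem_univ _, h⟩)

theorem IsDoubleWalk.integral_le {n L : ℕ} {p : Fin n → Fin n → ℝ} {q : ℝ}
    (h0 : ∀ i j, 0 ≤ p i j) (h1 : ∀ i j, p i j ≤ 1) (hp : ∀ i j, p i j = p j i)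
    (hq0 : 0 ≤ q) (hq1 : q ≤ 1) (hpq : ∀ i j, p i j ≤ q)
    {u : Fin (L + 1) → Fin n} (hu : IsDoubleWalk u) :
    ∫ ω, ∏ t : Fin L, centeredMat p ω (u t.castSucc) (u t.succ) ∂genMeasure p ≤
      q ^ ((univ.image u).card - 1) := by
  rw [integral_walk_eq_prod h0 h1 hp u hu.2.1]
  have hcard := card_image_le_card_image_edges_add_one u (fun t => edgeOf _ _ (hu.2.1 t))
    fun s t h => (edgeOf_eq_iff _ _).1 h
  refine (le_abs_self _).trans ?_
  rw [Finset.abs_prod, ← Finset.prod_subset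
    (Finset.subset_univ (univ.image fun t => edgeOf _ _ (hu.2.1 t)))
    fun e _ he => by rw [card_fiber_of_notMem he, bernMoment_zero, abs_one]]
  refine (Finset.prod_le_prod (g := fun _ => q) (fun _ _ => abs_nonneg _) fun e he => ?_).trans ?_
  · obtain ⟨m, hm⟩ := hu.card_fiber he
    rw [hm]
    exact (abs_bernMoment_le (h0 _ _) (h1 _ _) m).trans (hpq _ _)
  · rw [Finset.prod_const]
    exact pow_le_pow_of_le_one hq0 hq1 (by omega)

theorem IsDoubleWalk.one_le_integral {n L : ℕ} {u : Fin (L + 1) → Fin n} (hu : IsDoubleWalk u) :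
    1 ≤ 3 ^ L * ∫ ω, ∏ t : Fin L, centeredMat (fun _ _ => 1 / 3) ω (u t.castSucc) (u t.succ)
      ∂genMeasure (n := n) (fun _ _ => 1 / 3) := by
  rw [integral_walk_eq_prod (fun _ _ => by norm_num) (fun _ _ => by norm_num) (fun _ _ => rfl) u
    hu.2.1]
  have hL : (3 : ℝ) ^ L = ∏ e : EdgeIdx n,
      3 ^ (univ.filter fun t : Fin L => edgeOf _ _ (hu.2.1 t) = e).card := by
    rw [Finset.prod_pow_eq_pow_sum, ← Finset.card_eq_sum_card_fiberwise fun _ _ => mem_univ _]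
    simp
  rw [hL, ← Finset.prod_mul_distrib]
  refine Finset.one_le_prod fun e _ => ?_
  by_cases he : e ∈ univ.image fun t => edgeOf _ _ (hu.2.1 t)
  · obtain ⟨m, hm⟩ := hu.card_fiber he
    rw [hm]
    exact one_le_pow_mul_bernMoment_third m
  · rw [card_fiber_of_notMem he, bernMoment_zero]
    simp

theorem integral_trace_pow {n : ℕ} (p : Fin n → Fin n → ℝ) (L : ℕ) :
    ∫ ω, (centeredMat p ω ^ L).trace ∂genMeasure p =
      ∑ u : Fin (L + 1) → Fin n, if u 0 = u (Fin.last L) then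
        ∫ ω, ∏ t : Fin L, centeredMat p ω (u t.castSucc) (u t.succ) ∂genMeasure p else 0 := by
  simp_rw [trace_pow_eq_sum_walks]
  rw [integral_finsetSum _ fun _ _ => Integrable.of_finite]
  refine Finset.sum_congr rfl fun u _ => ?_
  split_ifs
  · rfl
  · simp

/-- Comparison of trace moments with those of a matrix of size `2 * k` with entries of constant
order. -/
theorem integral_trace_pow_le {n k : ℕ} {p : Fin n → Fin n → ℝ} {q : ℝ}
    (h0 : ∀ i j, 0 ≤ p i j) (h1 : ∀ i j, p i j ≤ 1) (hp : ∀ i j, p i j = p j i)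
    (hq0 : 0 ≤ q) (hq1 : q ≤ 1) (hpq : ∀ i j, p i j ≤ q) (hk : n * q ≤ k) :
    2 * k * ∫ ω, (centeredMat p ω ^ (2 * k)).trace ∂genMeasure p ≤
      n * (3 ^ (2 * k) * ∫ ω, (centeredMat (n := 2 * k) (fun _ _ => 1 / 3) ω ^ (2 * k)).trace
        ∂genMeasure (n := 2 * k) (fun _ _ => 1 / 3)) := by
  classical
  rw [integral_trace_pow, integral_trace_pow]
  refine le_trans ?_ ((sum_isDoubleWalk_le hq0 hk).trans ?_)
  · gcongr with u
    split_ifs with hc hu hu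
    · exact hu.integral_le h0 h1 hp hq0 hq1 hpq
    · exact (integral_walk_eq_zero h0 h1 hp u hc hu).le
    · exact absurd hu.1 hc
    · rfl
  · refine mul_le_mul_of_nonneg_left ?_ (Nat.cast_nonneg n)
    rw [Finset.mul_sum]
    gcongr with u
    split_ifs with hu hc hc
    · exact hu.one_le_integral
    · exact absurd hu.1 hc
    · rw [integral_walk_eq_zero (fun _ _ => by norm_num) (fun _ _ => by norm_num)
        (fun _ _ => rfl) u hc hu, mul_zero]
    · simp

theorem exists_finset_half_cover (E : Type*) [NormedAddCommGroup E] [NormedSpace ℝ E]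
    [FiniteDimensional ℝ E] :
    ∃ N : Finset E, (∀ c ∈ N, ‖c‖ ≤ 1) ∧ N.card ≤ 5 ^ Module.finrank ℝ E ∧
      ∀ x : E, ‖x‖ ≤ 1 → ∃ c ∈ N, ‖x - c‖ ≤ 1 / 2 := by
  classical
  let P : Finset E → Prop := fun s =>
    (∀ c ∈ s, ‖c‖ ≤ 1) ∧ ∀ c ∈ s, ∀ d ∈ s, c ≠ d → 1 / 2 ≤ ‖c - d‖
  have hcard : ∀ s, P s → s.card ≤ 5 ^ Module.finrank ℝ E := by
    intro s hs
    have hinj : Function.Injective fun x : E => (2 : ℝ) • x :=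
      smul_right_injective E (by norm_num)
    rw [← Finset.card_image_of_injective s hinj]
    refine Besicovitch.card_le_of_separated _ ?_ ?_
    · intro c hc
      obtain ⟨x, hx, rfl⟩ := Finset.mem_image.1 hc
      rw [norm_smul, Real.norm_ofNat]
      linarith [hs.1 x hx]
    · intro c hc d hd hcd
      obtain ⟨x, hx, rfl⟩ := Finset.mem_image.1 hc
      obtain ⟨y, hy, rfl⟩ := Finset.mem_image.1 hd
      have := hs.2 x hx y hy fun h => hcd (by rw [h])
      rw [← smul_sub, norm_smul, Real.norm_ofNat]
      linarith
  let S : Set ℕ := {m | ∃ s, P s ∧ s.card = m}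
  have hne : S.Nonempty := ⟨0, ∅, by simp [P], rfl⟩
  have hbdd : BddAbove S := ⟨_, by rintro _ ⟨s, hs, rfl⟩; exact hcard s hs⟩
  obtain ⟨N, hN, hNc⟩ := Nat.sSup_mem hne hbdd
  refine ⟨N, hN.1, hcard N hN, fun x hx => ?_⟩
  by_contra! h
  have hxN : x ∉ N := fun hmem => by
    have := h x hmem
    rw [sub_self, norm_zero] at this
    linarith
  have hP : P (insert x N) := by
    refine ⟨?_, ?_⟩
    · intro c hc
      rcases Finset.mem_insert.1 hc with rfl | hc
      exacts [hx, hN.1 c hc]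
    · intro c hc d hd hcd
      rcases Finset.mem_insert.1 hc with rfl | hc' <;> rcases Finset.mem_insert.1 hd with rfl | hd'
      · exact absurd rfl hcd
      · exact (h d hd').le
      · rw [norm_sub_rev]; exact (h c hc').le
      · exact hN.2 c hc' d hd' hcd
  have := le_csSup hbdd ⟨_, hP, rfl⟩
  rw [Finset.card_insert_of_notMem hxN, hNc] at this
  omega

theorem norm_le_of_half_cover {E : Type*} [NormedAddCommGroup E] [InnerProductSpace ℝ E]
    {N : Finset E} (hN : ∀ x : E, ‖x‖ ≤ 1 → ∃ c ∈ N, ‖x - c‖ ≤ 1 / 2) {z : E} {B : ℝ}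
    (hB : ∀ y ∈ N, |inner ℝ y z| ≤ B) : ‖z‖ ≤ 2 * B := by
  obtain rfl | hz := eq_or_ne z 0
  · obtain ⟨c, hc, -⟩ := hN 0 (by simp)
    have := hB c hc
    simp at this ⊢
    exact this
  have hz' : ‖z‖ ≠ 0 := norm_ne_zero_iff.2 hz
  obtain ⟨c, hc, hcx⟩ := hN (‖z‖⁻¹ • z) (by rw [norm_smul, norm_inv, norm_norm]; field_simp; rfl)
  have h1 : inner ℝ (‖z‖⁻¹ • z) z = ‖z‖ := by
    rw [real_inner_smul_left, real_inner_self_eq_norm_sq]; field_simp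
  have h2 : inner ℝ (‖z‖⁻¹ • z) z = inner ℝ (‖z‖⁻¹ • z - c) z + inner ℝ c z := by
    rw [← inner_add_left, sub_add_cancel]
  have h3 := (real_inner_le_norm (‖z‖⁻¹ • z - c) z).trans
    (mul_le_mul_of_nonneg_right hcx (norm_nonneg z))
  have h4 := (le_abs_self _).trans (hB c hc)
  linarith

/-- The norm of an operator is controlled by its bilinear form on a half-cover of the ball. -/
theorem norm_pow_le_sum_half_cover {E : Type*} [NormedAddCommGroup E] [InnerProductSpace ℝ E]
    {N : Finset E} (hN : ∀ x : E, ‖x‖ ≤ 1 → ∃ c ∈ N, ‖x - c‖ ≤ 1 / 2) (A : E →L[ℝ] E) (k : ℕ) :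
    ‖A‖ ^ (2 * k) ≤ 16 ^ k * ∑ z ∈ N ×ˢ N, (inner ℝ z.1 (A z.2)) ^ (2 * k) := by
  have hne : (N ×ˢ N).Nonempty := by
    obtain ⟨c, hc, -⟩ := hN 0 (by simp)
    exact ⟨(c, c), Finset.mem_product.2 ⟨hc, hc⟩⟩
  obtain ⟨w, hw, hmax⟩ := Finset.exists_max_image (N ×ˢ N) (fun z => |inner ℝ z.1 (A z.2)|) hne
  set B := |inner ℝ w.1 (A w.2)| with hB
  have hB0 : 0 ≤ B := abs_nonneg _
  have h1 : ∀ x ∈ N, ‖A x‖ ≤ 2 * B := fun x hx =>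
    norm_le_of_half_cover hN fun y hy => hmax (y, x) (Finset.mem_product.2 ⟨hy, hx⟩)
  have h2 : ‖A‖ ≤ 2 * B + ‖A‖ / 2 := by
    refine ContinuousLinearMap.opNorm_le_of_unit_norm (by positivity) fun x hx => ?_
    obtain ⟨c, hc, hcx⟩ := hN x hx.le
    calc ‖A x‖ = ‖A c + A (x - c)‖ := by rw [← map_add, add_sub_cancel]
      _ ≤ ‖A c‖ + ‖A‖ * ‖x - c‖ := (norm_add_le _ _).trans (by gcongr; exact A.le_opNorm _)
      _ ≤ 2 * B + ‖A‖ * (1 / 2) := by gcongr; exact h1 c hc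
      _ = _ := by ring
  calc ‖A‖ ^ (2 * k) ≤ (4 * B) ^ (2 * k) := by gcongr; linarith
    _ = 16 ^ k * (inner ℝ w.1 (A w.2)) ^ (2 * k) := by
      rw [mul_pow, hB, (even_two_mul k).pow_abs, pow_mul]; norm_num
    _ ≤ _ := by
      gcongr
      exact Finset.single_le_sum (f := fun z : E × E => (inner ℝ z.1 (A z.2)) ^ (2 * k))
        (fun z _ => (even_two_mul k).pow_nonneg _) hw

theorem integral_exp_bern_le {p : ℝ} (h0 : 0 ≤ p) (h1 : p ≤ 1) (s : ℝ) :
    ∫ b, Real.exp (s * ((if b then 1 else 0) - p)) ∂bern p ≤ Real.exp (s ^ 2 / 8) := by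
  have h := (ProbabilityTheory.hasSubgaussianMGF_of_mem_Icc (μ := bern p)
    (X := fun b : Bool => if b then (1 : ℝ) else 0) (a := 0) (b := 1)
    (measurable_of_finite _).aemeasurable
    (Filter.Eventually.of_forall fun b => by cases b <;> simp)).mgf_le s
  have hm : ∫ b, (if b then (1 : ℝ) else 0) ∂bern p = p := by
    rw [integral_bern h0 h1]; simp
  rw [ProbabilityTheory.mgf, hm] at h
  refine h.trans (le_of_eq ?_)
  congr 1
  norm_num
  ring

theorem sum_eq_sum_edgeIdx {n : ℕ} (F : Fin n → Fin n → ℝ) (hF : ∀ i, F i i = 0) :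
    ∑ i, ∑ j, F i j = ∑ e : EdgeIdx n, (F e.1.1 e.1.2 + F e.1.2 e.1.1) := by
  have h1 : ∀ i j, F i j = (if i < j then F i j else 0) + if j < i then F i j else 0 := by
    intro i j
    rcases lt_trichotomy i j with h | rfl | h
    · simp [h, h.not_gt]
    · simp [hF]
    · simp [h, h.not_gt]
  have h2 : ∑ i, ∑ j, (if j < i then F i j else 0) = ∑ i, ∑ j, if i < j then F j i else 0 :=
    Finset.sum_comm
  calc ∑ i, ∑ j, F i j = ∑ i, ∑ j, if i < j then F i j + F j i else 0 := by
        conv_lhs => enter [2, i, 2, j]; rw [h1 i j]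
        simp_rw [Finset.sum_add_distrib]
        rw [h2]
        simp_rw [← Finset.sum_add_distrib]
        refine Finset.sum_congr rfl fun i _ => Finset.sum_congr rfl fun j _ => ?_
        split_ifs <;> simp
    _ = ∑ e ∈ (univ : Finset (Fin n × Fin n)).filter (fun e => e.1 < e.2),
          (F e.1 e.2 + F e.2 e.1) := by
        rw [Finset.sum_filter, Fintype.sum_prod_type]
    _ = _ := (Finset.sum_subtype _ (by simp) _)

theorem inner_centeredMat_eq_sum {n : ℕ} {p : Fin n → Fin n → ℝ} (hp : ∀ i j, p i j = p j i)
    (ω : Config n) (x y : EuclideanSpace ℝ (Fin n)) :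
    inner ℝ y (Matrix.toEuclideanCLM (n := Fin n) (𝕜 := ℝ) (centeredMat p ω) x) =
      ∑ e : EdgeIdx n, (y e.1.1 * x e.1.2 + y e.1.2 * x e.1.1) *
        ((if ω e then 1 else 0) - p e.1.1 e.1.2) := by
  rw [Matrix.inner_toEuclideanCLM]
  simp only [dotProduct, Matrix.mulVec, Finset.mul_sum]
  rw [sum_eq_sum_edgeIdx (fun i j => y i * (centeredMat p ω i j * x j)) fun i => by
    simp [centeredMat_self]]
  refine Finset.sum_congr rfl fun e _ => ?_
  have h : centeredMat p ω e.1.1 e.1.2 = (if ω e then 1 else 0) - p e.1.1 e.1.2 := by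
    simp [centeredMat, adjOf, e.2.ne, e.2]
  have h' : centeredMat p ω e.1.2 e.1.1 = (if ω e then 1 else 0) - p e.1.1 e.1.2 :=
    ((centeredMat_isSymm hp ω).apply e.1.1 e.1.2).trans h
  rw [h', h]
  ring

theorem integral_exp_inner_le {n : ℕ} {p : Fin n → Fin n → ℝ} (h0 : ∀ i j, 0 ≤ p i j)
    (h1 : ∀ i j, p i j ≤ 1) (hp : ∀ i j, p i j = p j i) {x y : EuclideanSpace ℝ (Fin n)}
    (hx : ‖x‖ ≤ 1) (hy : ‖y‖ ≤ 1) (s : ℝ) :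
    ∫ ω, Real.exp (s * inner ℝ y (Matrix.toEuclideanCLM (n := Fin n) (𝕜 := ℝ)
      (centeredMat p ω) x)) ∂genMeasure p ≤ Real.exp (s ^ 2 / 4) := by
  have hc : ∑ e : EdgeIdx n, (y e.1.1 * x e.1.2 + y e.1.2 * x e.1.1) ^ 2 ≤ 2 := by
    calc ∑ e : EdgeIdx n, (y e.1.1 * x e.1.2 + y e.1.2 * x e.1.1) ^ 2
        ≤ ∑ e : EdgeIdx n, 2 * ((y e.1.1 * x e.1.2) ^ 2 + (y e.1.2 * x e.1.1) ^ 2) :=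
          Finset.sum_le_sum fun e _ => add_sq_le
      _ = 2 * ∑ i, ∑ j, if i = j then 0 else (y i * x j) ^ 2 := by
          rw [← Finset.mul_sum, sum_eq_sum_edgeIdx _ (by simp)]
          congr 1
          refine Finset.sum_congr rfl fun e _ => ?_
          rw [if_neg e.2.ne, if_neg e.2.ne']
      _ ≤ 2 * ∑ i, ∑ j, y i ^ 2 * x j ^ 2 := by
          gcongr with i _ j
          split_ifs
          · positivity
          · rw [mul_pow]
      _ = 2 * (‖y‖ ^ 2 * ‖x‖ ^ 2) := by
          simp_rw [EuclideanSpace.norm_sq_eq, Finset.sum_mul_sum, Real.norm_eq_abs, sq_abs]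
      _ ≤ 2 * (1 ^ 2 * 1 ^ 2) := by gcongr
      _ = 2 := by norm_num
  simp_rw [inner_centeredMat_eq_sum hp, Finset.mul_sum, Real.exp_sum, ← mul_assoc]
  rw [genMeasure, integral_fintype_prod_eq_prod (f := fun (e : EdgeIdx n) (b : Bool) =>
    Real.exp (s * (y e.1.1 * x e.1.2 + y e.1.2 * x e.1.1) *
      ((if b then 1 else 0) - p e.1.1 e.1.2)))]
  calc _ ≤ ∏ e : EdgeIdx n,
        Real.exp ((s * (y e.1.1 * x e.1.2 + y e.1.2 * x e.1.1)) ^ 2 / 8) :=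
        Finset.prod_le_prod (fun _ _ => integral_nonneg fun _ => (Real.exp_pos _).le)
          fun e _ => integral_exp_bern_le (h0 _ _) (h1 _ _) _
    _ = Real.exp (s ^ 2 / 8 * ∑ e : EdgeIdx n, (y e.1.1 * x e.1.2 + y e.1.2 * x e.1.1) ^ 2) := by
        rw [← Real.exp_sum, Finset.mul_sum]
        congr 1
        exact Finset.sum_congr rfl fun e _ => by ring
    _ ≤ _ := by
        gcongr
        nlinarith [sq_nonneg s]

theorem pow_two_mul_le_exp {z : ℝ} {k : ℕ} (hk : 0 < k) :
    z ^ (2 * k) ≤ (2 * k) ^ (2 * k) * (Real.exp z + Real.exp (-z)) := by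
  have hk' : (0 : ℝ) < 2 * k := by positivity
  have h1 : |z| / (2 * k) ≤ Real.exp (|z| / (2 * k)) := by
    linarith [Real.add_one_le_exp (|z| / (2 * k))]
  have h2 : (|z| / (2 * k)) ^ (2 * k) ≤ Real.exp |z| := by
    calc _ ≤ Real.exp (|z| / (2 * k)) ^ (2 * k) := by gcongr
      _ = Real.exp |z| := by
        rw [← Real.exp_nat_mul]
        congr 1
        push_cast
        field_simp
  have h3 : Real.exp |z| ≤ Real.exp z + Real.exp (-z) := by
    rcases abs_cases z with ⟨h, -⟩ | ⟨h, -⟩ <;> rw [h]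
    · linarith [Real.exp_pos (-z)]
    · linarith [Real.exp_pos z]
  rw [div_pow, (even_two_mul k).pow_abs, div_le_iff₀ (by positivity)] at h2
  calc z ^ (2 * k) ≤ Real.exp |z| * (2 * k) ^ (2 * k) := h2
    _ ≤ _ := by rw [mul_comm]; gcongr

theorem integral_inner_pow_le {n : ℕ} {p : Fin n → Fin n → ℝ} (h0 : ∀ i j, 0 ≤ p i j)
    (h1 : ∀ i j, p i j ≤ 1) (hp : ∀ i j, p i j = p j i) {x y : EuclideanSpace ℝ (Fin n)}
    (hx : ‖x‖ ≤ 1) (hy : ‖y‖ ≤ 1) {k : ℕ} (hk : 0 < k) :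
    ∫ ω, (inner ℝ y (Matrix.toEuclideanCLM (n := Fin n) (𝕜 := ℝ) (centeredMat p ω) x)) ^ (2 * k)
      ∂genMeasure p ≤ 2 * (12 * k) ^ k := by
  set S : Config n → ℝ := fun ω =>
    inner ℝ y (Matrix.toEuclideanCLM (n := Fin n) (𝕜 := ℝ) (centeredMat p ω) x) with hS
  have hk' : (0 : ℝ) < k := by exact_mod_cast hk
  have hexp : Real.exp (k / 4) ≤ 3 ^ k := by
    calc Real.exp (k / 4) ≤ Real.exp k := by gcongr; linarith
      _ = Real.exp 1 ^ k := by rw [← Real.exp_nat_mul, mul_one]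
      _ ≤ 3 ^ k := by gcongr; linarith [Real.exp_one_lt_d9]
  have hpt : ∀ ω, k ^ k * S ω ^ (2 * k) ≤ (2 * k) ^ (2 * k) *
      (Real.exp (√k * S ω) + Real.exp (-√k * S ω)) := by
    intro ω
    have := pow_two_mul_le_exp (z := √k * S ω) hk
    rwa [mul_pow, pow_mul (√(k : ℝ)), Real.sq_sqrt hk'.le, ← neg_mul] at this
  have hint := integral_mono (μ := genMeasure p) Integrable.of_finite Integrable.of_finite hpt
  rw [integral_const_mul, integral_const_mul,
    integral_add Integrable.of_finite Integrable.of_finite] at hint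
  have e1 := integral_exp_inner_le h0 h1 hp hx hy (√k)
  have e2 := integral_exp_inner_le h0 h1 hp hx hy (-√k)
  rw [neg_sq] at e2
  rw [Real.sq_sqrt hk'.le] at e1 e2
  have hfin : (k : ℝ) ^ k * ∫ ω, S ω ^ (2 * k) ∂genMeasure p ≤ k ^ k * (2 * (12 * k) ^ k) := by
    calc _ ≤ _ := hint
      _ ≤ (2 * k) ^ (2 * k) * (3 ^ k + 3 ^ k) := by
        gcongr
        exacts [e1.trans hexp, e2.trans hexp]
      _ = k ^ k * (2 * (12 * k) ^ k) := by
        rw [pow_mul, show (12 * k : ℝ) = 4 * 3 * k by norm_num, mul_pow, mul_pow, mul_pow, mul_pow,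
          sq (k : ℝ), mul_pow]
        norm_num
        ring
  exact le_of_mul_le_mul_left hfin (by positivity)

/-- High moments of the norm of a centered matrix of size `n`. -/
theorem integral_opNorm_pow_le {n : ℕ} {p : Fin n → Fin n → ℝ} (h0 : ∀ i j, 0 ≤ p i j)
    (h1 : ∀ i j, p i j ≤ 1) (hp : ∀ i j, p i j = p j i) {k : ℕ} (hk : 0 < k) :
    ∫ ω, opNorm (centeredMat p ω) ^ (2 * k) ∂genMeasure p ≤
      16 ^ k * (25 ^ n * (2 * (12 * k) ^ k)) := by
  obtain ⟨N, hN1, hNc, hN⟩ := exists_finset_half_cover (EuclideanSpace ℝ (Fin n))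
  have hint := integral_mono (μ := genMeasure p) Integrable.of_finite Integrable.of_finite
    fun ω => norm_pow_le_sum_half_cover hN
      (Matrix.toEuclideanCLM (n := Fin n) (𝕜 := ℝ) (centeredMat p ω)) k
  refine hint.trans ?_
  rw [integral_const_mul, integral_finsetSum _ fun _ _ => Integrable.of_finite]
  gcongr
  have hcard : ((N ×ˢ N).card : ℝ) ≤ 25 ^ n := by
    rw [finrank_euclideanSpace_fin] at hNc
    rw [Finset.card_product]
    calc ((N.card * N.card : ℕ) : ℝ) ≤ ((5 ^ n * 5 ^ n : ℕ) : ℝ) := by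
          exact_mod_cast Nat.mul_le_mul hNc hNc
      _ = 25 ^ n := by push_cast; rw [← mul_pow]; norm_num
  calc _ ≤ ∑ _z ∈ N ×ˢ N, (2 * (12 * k) ^ k : ℝ) := Finset.sum_le_sum fun z hz =>
        integral_inner_pow_le h0 h1 hp (hN1 _ (Finset.mem_product.1 hz).2)
          (hN1 _ (Finset.mem_product.1 hz).1) hk
    _ = (N ×ˢ N).card * (2 * (12 * k) ^ k) := by rw [Finset.sum_const, nsmul_eq_mul]
    _ ≤ _ := by gcongr

theorem integral_opNorm_pow_le_of_le {n k : ℕ} {p : Fin n → Fin n → ℝ} {q : ℝ}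
    (h0 : ∀ i j, 0 ≤ p i j) (h1 : ∀ i j, p i j ≤ 1) (hp : ∀ i j, p i j = p j i)
    (hq0 : 0 ≤ q) (hq1 : q ≤ 1) (hpq : ∀ i j, p i j ≤ q) (hk0 : 0 < k) (hk : n * q ≤ k) :
    ∫ ω, opNorm (centeredMat p ω) ^ (2 * k) ∂genMeasure p ≤ 2 * n * (1080000 * k) ^ k := by
  obtain ⟨r, rfl⟩ : ∃ r, k = r + 1 := ⟨k - 1, by omega⟩
  obtain ⟨k, hkr⟩ : ∃ k, k = r + 1 := ⟨_, rfl⟩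
  rw [← hkr] at hk0 hk ⊢
  have hk' : (0 : ℝ) < k := by exact_mod_cast hk0
  let ν := genMeasure (n := 2 * k) fun _ _ => 1 / 3
  let Y : Config (2 * k) → Matrix (Fin (2 * k)) (Fin (2 * k)) ℝ :=
    centeredMat (n := 2 * k) fun _ _ => 1 / 3
  have hY : ∫ ω, (Y ω ^ (2 * k)).trace ∂ν ≤
      (2 * k) * (16 ^ k * (25 ^ (2 * k) * (2 * (12 * k) ^ k))) := by
    calc ∫ ω, (Y ω ^ (2 * k)).trace ∂ν ≤ ∫ ω, (2 * k) * opNorm (Y ω) ^ (2 * k) ∂ν := by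
          refine integral_mono Integrable.of_finite Integrable.of_finite fun ω => ?_
          have := trace_pow_le (Y ω) (2 * r + 1)
          rw [show 2 * r + 1 + 1 = 2 * k by omega] at this
          exact_mod_cast this
      _ ≤ _ := by
          rw [integral_const_mul]
          gcongr
          exact integral_opNorm_pow_le (fun _ _ => by norm_num) (fun _ _ => by norm_num)
            (fun _ _ => rfl) hk0
  have hcmp := integral_trace_pow_le h0 h1 hp hq0 hq1 hpq hk
  have hM : ∫ ω, opNorm (centeredMat p ω) ^ (2 * k) ∂genMeasure p ≤
      ∫ ω, (centeredMat p ω ^ (2 * k)).trace ∂genMeasure p := by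
    refine integral_mono Integrable.of_finite Integrable.of_finite fun ω => ?_
    rw [hkr]
    exact opNorm_pow_le_trace (centeredMat_isSymm hp ω) r
  refine le_of_mul_le_mul_left ?_ (show (0 : ℝ) < 2 * k by positivity)
  calc 2 * k * ∫ ω, opNorm (centeredMat p ω) ^ (2 * k) ∂genMeasure p
      ≤ 2 * k * ∫ ω, (centeredMat p ω ^ (2 * k)).trace ∂genMeasure p := by gcongr
    _ ≤ _ := hcmp
    _ ≤ n * (3 ^ (2 * k) * ((2 * k) * (16 ^ k * (25 ^ (2 * k) * (2 * (12 * k) ^ k))))) := by gcongr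
    _ = 2 * k * (2 * n * (1080000 * k) ^ k) := by
      have e : (1080000 * k : ℝ) ^ k = 3 ^ (2 * k) * 16 ^ k * 25 ^ (2 * k) * (12 * k) ^ k := by
        rw [pow_mul, pow_mul, ← mul_pow, ← mul_pow, ← mul_pow]
        congr 1
        ring
      rw [e]
      ring

/-- Tail bound for the norm of a centered matrix in the regime of at least logarithmic degrees. -/
theorem measureReal_opNorm_gt_le {n : ℕ} {p : Fin n → Fin n → ℝ} {q : ℝ}
    (h0 : ∀ i j, 0 ≤ p i j) (h1 : ∀ i j, p i j ≤ 1) (hp : ∀ i j, p i j = p j i)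
    (hq0 : 0 ≤ q) (hq1 : q ≤ 1) (hpq : ∀ i j, p i j ≤ q) (hn : 0 < n)
    (hlog : 2 * Real.log n ≤ n * q) (hnq : 1 ≤ n * q) :
    (genMeasure p).real {ω | 3000 * √(n * q) ≤ opNorm (centeredMat p ω)} ≤ 2 / n := by
  have hn' : (0 : ℝ) < n := by exact_mod_cast hn
  set k := ⌈n * q⌉₊ with hkdef
  have hk : n * q ≤ k := Nat.le_ceil _
  have hk2 : (k : ℝ) ≤ 2 * (n * q) := by linarith [Nat.ceil_lt_add_one (mul_nonneg hn'.le hq0)]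
  have hk0 : 0 < k := Nat.ceil_pos.2 (by linarith)
  have hmom := integral_opNorm_pow_le_of_le h0 h1 hp hq0 hq1 hpq hk0 hk
  have hmarkov := mul_meas_ge_le_integral_of_nonneg (μ := genMeasure p)
    (f := fun ω => opNorm (centeredMat p ω) ^ (2 * k))
    (Filter.Eventually.of_forall fun ω => (even_two_mul k).pow_nonneg _)
    Integrable.of_finite ((9000000 * (n * q)) ^ k)
  have hsub : {ω | 3000 * √(n * q) ≤ opNorm (centeredMat p ω)} ⊆
      {ω | (9000000 * (n * q)) ^ k ≤ opNorm (centeredMat p ω) ^ (2 * k)} := by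
    intro ω hω
    have h : (3000 * √(n * q)) ^ (2 * k) ≤ opNorm (centeredMat p ω) ^ (2 * k) := by
      gcongr
      exact hω
    rw [pow_mul, mul_pow, Real.sq_sqrt (by positivity)] at h
    norm_num at h
    exact h
  have hmeas := measureReal_mono (μ := genMeasure p) hsub
  have hexp : (n : ℝ) ^ 2 ≤ 3 ^ k := by
    calc (n : ℝ) ^ 2 = Real.exp (2 * Real.log n) := by
          rw [two_mul, Real.exp_add, Real.exp_log hn', sq]
      _ ≤ Real.exp k := by gcongr; linarith
      _ = Real.exp 1 ^ k := by rw [← Real.exp_nat_mul, mul_one]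
      _ ≤ 3 ^ k := by gcongr; linarith [Real.exp_one_lt_d9]
  set P := (genMeasure p).real {ω | 3000 * √(n * q) ≤ opNorm (centeredMat p ω)} with hP
  have hP0 : 0 ≤ P := measureReal_nonneg
  have hmain : (1080000 * k : ℝ) ^ k * (3 ^ k * P) ≤ (1080000 * k) ^ k * (2 * n) := by
    calc (1080000 * k : ℝ) ^ k * (3 ^ k * P) = (3240000 * k) ^ k * P := by
          rw [← mul_assoc, ← mul_pow]; ring_nf
      _ ≤ (9000000 * (n * q)) ^ k * P := by gcongr ?_ ^ k * P; linarith
      _ ≤ (9000000 * (n * q)) ^ k * (genMeasure p).real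
          {ω | (9000000 * (n * q)) ^ k ≤ opNorm (centeredMat p ω) ^ (2 * k)} := by gcongr
      _ ≤ _ := hmarkov
      _ ≤ _ := hmom
      _ = _ := by ring
  have hfin := le_of_mul_le_mul_left hmain (by positivity)
  rw [le_div_iff₀ hn']
  nlinarith [mul_le_mul_of_nonneg_right hexp hP0]

/-- Lemma A.1 / `thm:denseNorm`: for the random symmetric matrix `M`
with zero diagonal, independent entries `M_ij = 1 - p_ij` w.p. `p_ij` and `-p_ij`
otherwise, if `p_ij ≤ σ²` for all `i,j` and `σ² ≥ C₁ (log n)/n`, then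
`‖M‖ ≤ C₂ σ √n` with probability `1 - o(1)`. -/
theorem centered_random_matrix_norm_bound :
    ∃ C₁ C₂ : ℝ, 0 < C₂ ∧
      ∀ (p : (n : ℕ) → Fin n → Fin n → ℝ) (σ : ℕ → ℝ),
        (∀ n i j, 0 ≤ p n i j) → (∀ n i j, p n i j ≤ 1) →
        (∀ n i j, p n i j = p n j i) →
        (∀ n, 0 ≤ σ n) →
        (∀ n i j, p n i j ≤ σ n ^ 2) →
        (∀ n : ℕ, C₁ * Real.log n / n ≤ σ n ^ 2) →
        Tendsto
          (fun n => genMeasure (p n)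
            {ω | opNorm (centeredMat (p n) ω) ≤ C₂ * σ n * Real.sqrt n})
          atTop (nhds 1) := by
  refine ⟨2, 3000, by norm_num, fun p σ h0 h1 hp hσ hpσ hlog => ?_⟩
  have hbound : ∀ᶠ n : ℕ in atTop, ENNReal.ofReal (1 - 2 / n) ≤
      genMeasure (p n) {ω | opNorm (centeredMat (p n) ω) ≤ 3000 * σ n * Real.sqrt n} := by
    filter_upwards [eventually_ge_atTop 2] with n hn
    have hn2 : (2 : ℝ) ≤ n := by exact_mod_cast hn
    have hn0 : (0 : ℝ) < n := by linarith
    set q := min 1 (σ n ^ 2) with hq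
    have hq0 : 0 ≤ q := le_min zero_le_one (sq_nonneg _)
    have hlogn : 2 * Real.log n ≤ n := by
      have h := Real.log_le_sub_one_of_pos (Real.sqrt_pos.2 hn0)
      rw [Real.log_sqrt hn0.le] at h
      nlinarith [Real.sq_sqrt hn0.le, sq_nonneg (√(n : ℝ) - 2)]
    have hlogq : 2 * Real.log n ≤ n * q := by
      rw [hq, mul_min_of_nonneg _ _ hn0.le, mul_one]
      refine le_min hlogn ?_
      have := hlog n
      rwa [div_le_iff₀' hn0] at this
    have hlog2 : 1 ≤ 2 * Real.log n := by
      have := Real.log_le_log two_pos hn2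
      linarith [Real.log_two_gt_d9]
    have htail := measureReal_opNorm_gt_le (h0 n) (h1 n) (hp n) hq0 (min_le_left _ _)
      (fun i j => le_min (h1 n i j) (hpσ n i j)) (by omega) hlogq (hlog2.trans hlogq)
    have hthr : 3000 * √(n * q) ≤ 3000 * σ n * √n := by
      have : √(n * q) ≤ √n * σ n := by
        rw [Real.sqrt_mul hn0.le]
        gcongr
        exact (Real.sqrt_le_sqrt (min_le_right _ _)).trans_eq (Real.sqrt_sq (hσ n))
      linarith
    have hcompl := probReal_compl_eq_one_sub (μ := genMeasure (p n))
      (s := {ω | 3000 * √(n * q) ≤ opNorm (centeredMat (p n) ω)}) (Set.toFinite _).measurableSet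
    rw [← ofReal_measureReal (measure_ne_top _ _)]
    refine ENNReal.ofReal_le_ofReal (le_trans (b := (genMeasure (p n)).real
      {ω | 3000 * √(n * q) ≤ opNorm (centeredMat (p n) ω)}ᶜ) (by rw [hcompl]; linarith) ?_)
    refine measureReal_mono fun ω hω => ?_
    have hω' : opNorm (centeredMat (p n) ω) < 3000 * √(n * q) := not_le.1 hω
    exact hω'.le.trans hthr
  have hlim : Tendsto (fun n : ℕ => ENNReal.ofReal (1 - 2 / n)) atTop (nhds 1) := by
    have h : Tendsto (fun n : ℕ => (1 : ℝ) - 2 / n) atTop (nhds (1 - 0)) :=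
      tendsto_const_nhds.sub (tendsto_const_div_atTop_nhds_zero_nat 2)
    simpa using ENNReal.tendsto_ofReal h
  exact tendsto_of_tendsto_of_tendsto_of_le_of_le' hlim tendsto_const_nhds hbound
    (Filter.Eventually.of_forall fun n => prob_le_one)
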